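/- arXiv:math/0403060 — 2 statements merged into one kernel-verified Lean document; each statement's English description precedes it below -/
import Mathlib

section
/- The probability P_{0,ω}[X_n > 0 for all n > 0] that the walk started at 0 never returns to its initial point is monotone increasing in ω: if ω₁, ω₂ ∈ Ω₊ with ω₁(x,i) ≤ ω₂(x,i) for all x ∈ ℤ and i ≥ 1, then P_{0,ω₁}[∀ n > 0: X_n > 0] ≤ P_{0,ω₂}[∀ n > 0: X_n > 0]. -/
open MeasureTheory Filter Set Topology ProbabilityTheory
open scoped ENNReal ENat

noncomputable section

/-- A cookie environment: `ω z i` is the strength of the `(i+1)`-st cookie at site `z`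
(cookies at each site are indexed by `i = 0, 1, 2, …`). -/
abbrev CEnv : Type := ℤ → ℕ → ℝ

/-- `ω` belongs to `Ω₊`, i.e. all cookie strengths lie in `[1/2, 1]`. -/
def IsCookieEnv (ω : CEnv) : Prop := ∀ z i, ω z i ∈ Set.Icc (1/2 : ℝ) 1

/-- The number of visits of the path `x` to the site `x n` at times `m < n`. -/
def prevVisits (x : ℕ → ℤ) (n : ℕ) : ℕ :=
  ((Finset.range n).filter fun m => x m = x n).card

/-- The probability of the step from `x n` to `x (n+1)` for the multi-excited random
walk: jump to the right with the strength of the bottom remaining cookie at the current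
site, to the left with the complementary probability. -/
def stepProb (ω : CEnv) (x : ℕ → ℤ) (n : ℕ) : ℝ :=
  if x (n+1) = x n + 1 then ω (x n) (prevVisits x n)
  else if x (n+1) = x n - 1 then 1 - ω (x n) (prevVisits x n)
  else 0

/-- The probability that the walk started at `x0` follows the path `x` up to time `n`. -/
def cylProb (ω : CEnv) (x0 : ℤ) (x : ℕ → ℤ) (n : ℕ) : ℝ :=
  (if x 0 = x0 then 1 else 0) * ∏ m ∈ Finset.range n, stepProb ω x m

/-- `P` is the law `P_{x0,ω}` of the multi-excited random walk in the cookie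
environment `ω` started at `x0`, characterized by its cylinder probabilities. -/
def IsERWLaw (ω : CEnv) (x0 : ℤ) (P : Measure (ℕ → ℤ)) : Prop :=
  IsProbabilityMeasure P ∧
    ∀ (x : ℕ → ℤ) (n : ℕ),
      P {Y | ∀ m ≤ n, Y m = x m} = ENNReal.ofReal (cylProb ω x0 x n)

/-- First passage time `T_k`, with value `∞` if `k` is never visited. -/
def T (k : ℤ) (Y : ℕ → ℤ) : ℕ∞ :=
  sInf {t : ℕ∞ | ∃ n : ℕ, (n : ℕ∞) = t ∧ Y n = k}

/-- First passage time of an extended-real level, with the convention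
`T_{−∞} = T_{+∞} = ∞`. -/
def Te (k : EReal) (Y : ℕ → ℤ) : ℕ∞ :=
  sInf {t : ℕ∞ | ∃ n : ℕ, (n : ℕ∞) = t ∧ ((Y n : ℝ) : EReal) = k}

/-- `R_k`, the event that the site `k` is visited infinitely often. -/
def Rset (k : ℤ) : Set (ℕ → ℤ) := {Y | ∀ N : ℕ, ∃ n ≥ N, Y n = k}

/-- The number of visits of `Y` to the site `s` at times `< t`. -/
def visitsBefore (Y : ℕ → ℤ) (s : ℤ) (t : ℕ∞) : ℕ∞ :=
  {m : ℕ | (m : ℕ∞) < t ∧ Y m = s}.encard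

/-- `D_t^s`: the total drift stored in the cookies consumed at the site `s`
before time `t` (a time in `ℕ∞`; `t = ∞` gives `D_∞^s`). -/
def driftAt (ω : CEnv) (Y : ℕ → ℤ) (s : ℤ) (t : ℕ∞) : ℝ≥0∞ :=
  ∑' i : ℕ, Set.indicator {i : ℕ | (i : ℕ∞) < visitsBefore Y s t}
    (fun i => ENNReal.ofReal (2 * ω s i - 1)) i

/-- `D_t`: the total drift consumed before time `t` (at all sites). -/
def Dtot (ω : CEnv) (Y : ℕ → ℤ) (t : ℕ∞) : ℝ≥0∞ := ∑' s : ℤ, driftAt ω Y s t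

/-- `D_t^+`: the total drift consumed at nonnegative sites before time `t`. -/
def DtotPos (ω : CEnv) (Y : ℕ → ℤ) (t : ℕ∞) : ℝ≥0∞ := ∑' s : ℕ, driftAt ω Y (s : ℤ) t

/-- `δ^s`: the total drift stored in the cookies at the site `s`. -/
def cookieDrift (ω : CEnv) (s : ℤ) : ℝ≥0∞ := ∑' i : ℕ, ENNReal.ofReal (2 * ω s i - 1)

/-- The successive times `τ_{k,1}, τ_{k,2}, …` (indexed here from `0`) at which the
walk is at a site `≥ k`. -/
def tauT (k : ℤ) (Y : ℕ → ℤ) : ℕ → ℕ∞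
  | 0 => sInf {t : ℕ∞ | ∃ n : ℕ, (n : ℕ∞) = t ∧ k ≤ Y n}
  | m + 1 => sInf {t : ℕ∞ | ∃ n : ℕ, (n : ℕ∞) = t ∧ tauT k Y m < (n : ℕ∞) ∧ k ≤ Y n}

/-- The observed sequence `(X_{τ_{k,m}})_{m ≥ 1}` (indexed here from `0`). -/
def obsSeq (k : ℤ) (Y : ℕ → ℤ) (m : ℕ) : ℤ := Y (tauT k Y m).toNat

/-- The one-sided shift on sequences. -/
def shiftSeq {α : Type*} (u : ℕ → α) : ℕ → α := fun n => u (n + 1)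

/-- The restriction `(ω(x))_{x ≥ 0}` of an environment to the nonnegative sites. -/
def restrictNN (ω : CEnv) : ℕ → ℕ → ℝ := fun x => ω (x : ℤ)

/-- `(ω(x))_{x ≥ 0}` is stationary under `Pr`: its law is invariant under the shift. -/
def IsStationaryEnv (Pr : Measure CEnv) : Prop :=
  MeasurePreserving shiftSeq (Pr.map restrictNN) (Pr.map restrictNN)

/-- `(ω(x))_{x ≥ 0}` is stationary and ergodic under `Pr`. -/
def IsStatErgEnv (Pr : Measure CEnv) : Prop :=
  Ergodic shiftSeq (Pr.map restrictNN)

/-- The process `ξ_k = ((ω(x+k))_{x≥0}, (X_{τ_{k,m}} − k)_{m≥0})` consisting of the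
environment to the right of `k` and the trajectory at sites `≥ k`, recentered at `k`. -/
def xiProc (p : CEnv × (ℕ → ℤ)) (k : ℕ) : (ℕ → ℕ → ℝ) × (ℕ → ℤ) :=
  (fun x : ℕ => p.1 ((x : ℤ) + (k : ℤ)), fun m => obsSeq (k : ℤ) p.2 m - (k : ℤ))

namespace ArrowWalk

/-- `x` starts at `0` and follows the arrows `a`: at the `(i+1)`-st visit to `z` it steps to the
right if `a z i` holds and to the left otherwise. -/
def Follows (a : ℤ → ℕ → Prop) (x : ℕ → ℤ) : Prop :=
  x 0 = 0 ∧ ∀ n, (a (x n) (prevVisits x n) ∧ x (n + 1) = x n + 1) ∨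
    (¬ a (x n) (prevVisits x n) ∧ x (n + 1) = x n - 1)

/-- Number of visits of `x` to `z` before time `n`. -/
def visits (x : ℕ → ℤ) (n : ℕ) (z : ℤ) : ℕ := ((Finset.range n).filter fun m => x m = z).card

/-- Number of steps of `x` from `z` to `z + 1` before time `n`. -/
def ups (x : ℕ → ℤ) (n : ℕ) (z : ℤ) : ℕ :=
  ((Finset.range n).filter fun m => x m = z ∧ x (m + 1) = z + 1).card

/-- Number of steps of `x` from `z` to `z - 1` before time `n`. -/
def downs (x : ℕ → ℤ) (n : ℕ) (z : ℤ) : ℕ :=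
  ((Finset.range n).filter fun m => x m = z ∧ x (m + 1) = z - 1).card

open Classical in
/-- Number of right arrows among the first `k` arrows at `z`. -/
def rightArrows (a : ℤ → ℕ → Prop) (z : ℤ) (k : ℕ) : ℕ := ((Finset.range k).filter (a z)).card

lemma card_filter_range_succ (p : ℕ → Prop) [DecidablePred p] (n : ℕ) :
    ((Finset.range (n + 1)).filter p).card =
      ((Finset.range n).filter p).card + if p n then 1 else 0 := by
  rw [Finset.range_add_one, Finset.filter_insert]
  split_ifs <;> simp

lemma visits_succ (x : ℕ → ℤ) (n : ℕ) (z : ℤ) :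
    visits x (n + 1) z = visits x n z + if x n = z then 1 else 0 :=
  card_filter_range_succ _ _

lemma ups_succ (x : ℕ → ℤ) (n : ℕ) (z : ℤ) :
    ups x (n + 1) z = ups x n z + if x n = z ∧ x (n + 1) = z + 1 then 1 else 0 :=
  card_filter_range_succ _ _

lemma downs_succ (x : ℕ → ℤ) (n : ℕ) (z : ℤ) :
    downs x (n + 1) z = downs x n z + if x n = z ∧ x (n + 1) = z - 1 then 1 else 0 :=
  card_filter_range_succ _ _

lemma rightArrows_succ (a : ℤ → ℕ → Prop) (z : ℤ) (k : ℕ) [Decidable (a z k)] :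
    rightArrows a z (k + 1) = rightArrows a z k + if a z k then 1 else 0 := by
  classical
  rw [rightArrows, card_filter_range_succ]
  congr

lemma rightArrows_mono {a b : ℤ → ℕ → Prop} (hab : ∀ z i, a z i → b z i) (z : ℤ) {k l : ℕ}
    (hkl : k ≤ l) : rightArrows a z k ≤ rightArrows b z l := by
  classical
  refine Finset.card_le_card fun i hi => ?_
  simp only [Finset.mem_filter, Finset.mem_range] at hi ⊢
  exact ⟨by omega, hab _ _ hi.2⟩

lemma visits_mono (x : ℕ → ℤ) (z : ℤ) : Monotone fun n => visits x n z :=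
  monotone_nat_of_le_succ fun n => by simp only [visits_succ]; omega

variable {a b : ℤ → ℕ → Prop} {x y : ℕ → ℤ}

lemma Follows.ups_eq (h : Follows a x) (n : ℕ) (z : ℤ) :
    ups x n z = rightArrows a z (visits x n z) := by
  classical
  induction n with
  | zero => simp [ups, visits, rightArrows]
  | succ n ih =>
    rw [ups_succ, visits_succ, ih]
    by_cases hz : x n = z
    · subst hz
      rw [if_pos rfl, rightArrows_succ]
      rcases h.2 n with ⟨ha, hx⟩ | ⟨ha, hx⟩ <;>
        change _ = _ + if a (x n) (prevVisits x n) then _ else _ <;>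
        simp only [ha, hx] <;> simp
      omega
    · simp [hz]

lemma Follows.visits_eq (h : Follows a x) (n : ℕ) (z : ℤ) :
    visits x n z = ups x n z + downs x n z := by
  induction n with
  | zero => simp [ups, visits, downs]
  | succ n ih =>
    rw [ups_succ, visits_succ, downs_succ, ih]
    rcases h.2 n with ⟨-, hx⟩ | ⟨-, hx⟩ <;> split_ifs <;> omega

lemma Follows.ups_eq_downs (h : Follows a x) (n : ℕ) {z : ℤ} (hz : 0 < z) :
    ups x n (z - 1) = downs x n z + if z ≤ x n then 1 else 0 := by
  induction n with
  | zero => simp [ups, downs, h.1, hz]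
  | succ n ih =>
    rw [ups_succ, downs_succ, ih]
    rcases h.2 n with ⟨-, hx⟩ | ⟨-, hx⟩ <;> split_ifs <;> omega

/-- If the walk following the larger arrow system `b` is not positive at time `N > 0`, then a walk
following `a` which stays positive cannot use more arrows than the former has used by time `N`. -/
lemma Follows.visits_le (hx : Follows a x) (hy : Follows b y) (hab : ∀ z i, a z i → b z i)
    {N : ℕ} (hN : 0 < N) (hyN : y N ≤ 0) (hpos : ∀ n > 0, 0 < x n) (n : ℕ) (z : ℤ) (hz : 0 ≤ z) :
    visits x n z ≤ visits y N z := by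
  induction n generalizing z with
  | zero => simp [visits]
  | succ n ih =>
    rw [visits_succ]
    split_ifs with hxz
    · refine lt_of_le_of_ne (ih z hz) fun heq => ?_
      rcases Nat.eq_zero_or_pos n with rfl | hn
      · have h0 : z = 0 := by rw [← hxz, hx.1]
        have h1 : visits y 1 z ≤ visits y N z := visits_mono y z hN
        have h2 : visits y 1 z = 1 := by rw [visits_succ]; simp [visits, hy.1, h0]
        have h3 : visits x 0 z = 0 := by simp [visits]
        omega
      · have hzpos : 0 < z := hxz ▸ hpos n hn
        have e1 := hx.visits_eq n z
        have e2 := hx.ups_eq_downs n hzpos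
        have e3 := hy.visits_eq N z
        have e4 := hy.ups_eq_downs N hzpos
        rw [if_pos hxz.ge] at e2
        rw [if_neg (by omega)] at e4
        have l1 : ups x n z ≤ ups y N z := by
          rw [hx.ups_eq, hy.ups_eq]; exact rightArrows_mono hab z heq.le
        have l2 : ups x n (z - 1) ≤ ups y N (z - 1) := by
          rw [hx.ups_eq, hy.ups_eq]; exact rightArrows_mono hab _ (ih _ (by omega))
        omega
    · exact ih z hz

/-- Adding right arrows preserves the property of never returning to the starting point. -/
lemma Follows.forall_pos_mono (hx : Follows a x) (hy : Follows b y) (hab : ∀ z i, a z i → b z i)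
    (hpos : ∀ n > 0, 0 < x n) : ∀ n > 0, 0 < y n := by
  intro N hN
  by_contra! hyN
  have hnonneg : ∀ n, 0 ≤ x n := fun n => by
    rcases Nat.eq_zero_or_pos n with rfl | hn
    · exact hx.1.ge
    · exact (hpos n hn).le
  have h1 : N + 1 = ∑ z ∈ (Finset.range (N + 1)).image x, visits x (N + 1) z := by
    simpa [visits] using Finset.card_eq_sum_card_fiberwise (s := Finset.range (N + 1))
      (t := (Finset.range (N + 1)).image x) (f := x)
      (fun i hi => Finset.mem_coe.2 (Finset.mem_image_of_mem x hi))
  have h2 : ∑ z ∈ (Finset.range (N + 1)).image x, visits x (N + 1) z ≤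
      ∑ z ∈ (Finset.range (N + 1)).image x, visits y N z := by
    refine Finset.sum_le_sum fun z hz => hx.visits_le hy hab hN hyN hpos _ z ?_
    obtain ⟨m, -, rfl⟩ := Finset.mem_image.1 hz
    exact hnonneg m
  have h3 : ∑ z ∈ (Finset.range (N + 1)).image x, visits y N z ≤ N := by
    have := Finset.card_filter_le (Finset.range N)
      fun m => y m ∈ (Finset.range (N + 1)).image x
    rwa [← Finset.sum_card_fiberwise_eq_card_filter, Finset.card_range] at this
  omega

lemma prevVisits_congr {n : ℕ} (h : ∀ m ≤ n, x m = y m) : prevVisits x n = prevVisits y n := by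
  unfold prevVisits
  congr 1
  refine Finset.filter_congr fun m hm => ?_
  rw [h m (Finset.mem_range.1 hm).le, h n le_rfl]

lemma injective_site_prevVisits (x : ℕ → ℤ) :
    Function.Injective fun n => (x n, prevVisits x n) := by
  have key : ∀ m n, m < n → x m = x n → prevVisits x m < prevVisits x n := by
    intro m n hmn h
    have h1 : visits x (m + 1) (x n) ≤ visits x n (x n) := visits_mono x (x n) hmn
    rw [visits_succ, if_pos h] at h1
    have h2 : prevVisits x m = visits x m (x n) := by rw [← h]; rfl
    change _ < visits x n (x n)
    omega
  intro m n h
  obtain ⟨h1, h2⟩ := Prod.mk.inj h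
  rcases lt_trichotomy m n with hlt | heq | hlt
  · exact absurd h2 (key m n hlt h1).ne
  · exact heq
  · exact absurd h2 (key n m hlt h1.symm).ne'

open Classical in
/-- Path built step by step; only the values at times `≤ n` of the `n`-th path are relevant. -/
def partialWalk (a : ℤ → ℕ → Prop) : ℕ → ℕ → ℤ
  | 0 => fun _ => 0
  | n + 1 => Function.update (partialWalk a n) (n + 1)
      (if a (partialWalk a n n) (prevVisits (partialWalk a n) n) then partialWalk a n n + 1
        else partialWalk a n n - 1)

/-- The walk from `0` following the arrows `a`. -/
def walk (a : ℤ → ℕ → Prop) (n : ℕ) : ℤ := partialWalk a n n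

lemma partialWalk_eq_walk (a : ℤ → ℕ → Prop) {m n : ℕ} (h : m ≤ n) :
    partialWalk a n m = walk a m := by
  induction n, h using Nat.le_induction with
  | base => rfl
  | succ n hmn ih => rw [partialWalk, Function.update_of_ne (by omega), ih]

open Classical in
lemma follows_walk (a : ℤ → ℕ → Prop) : Follows a (walk a) := by
  refine ⟨rfl, fun n => ?_⟩
  have hp : prevVisits (partialWalk a n) n = prevVisits (walk a) n :=
    prevVisits_congr fun m hm => partialWalk_eq_walk a hm
  have hs : walk a (n + 1) = if a (walk a n) (prevVisits (walk a) n) then walk a n + 1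
      else walk a n - 1 := by
    rw [walk, partialWalk, Function.update_self, hp]
    rfl
  by_cases h : a (walk a n) (prevVisits (walk a) n)
  · exact Or.inl ⟨h, by rw [hs, if_pos h]⟩
  · exact Or.inr ⟨h, by rw [hs, if_neg h]⟩

/-- The walk following `a` runs along `x` up to time `n` iff all arrows met by `x` agree with `x`. -/
lemma walk_eq_iff (a : ℤ → ℕ → Prop) {x : ℕ → ℤ} (hx : x 0 = 0) (n : ℕ) :
    (∀ m ≤ n, walk a m = x m) ↔ ∀ m < n, (a (x m) (prevVisits x m) ∧ x (m + 1) = x m + 1) ∨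
      (¬ a (x m) (prevVisits x m) ∧ x (m + 1) = x m - 1) := by
  constructor
  · intro h m hm
    have := (follows_walk a).2 m
    rwa [h m hm.le, h (m + 1) hm, prevVisits_congr (y := x) fun k hk => h k (by omega)] at this
  · intro h
    induction n with
    | zero => intro m hm; obtain rfl : m = 0 := by omega
              rw [hx]; rfl
    | succ n ih =>
      have ih' := ih fun m hm => h m (by omega)
      intro m hm
      rcases Nat.lt_or_eq_of_le hm with hlt | rfl
      · exact ih' m (by omega)
      have h1 := (follows_walk a).2 n
      rw [ih' n le_rfl, prevVisits_congr (y := x) ih'] at h1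
      have h2 := h n (by omega)
      grind

/-- The uniform distribution on `[0, 1]`. -/
def unif : Measure ℝ := volume.restrict (Set.Icc 0 1)

instance : IsProbabilityMeasure unif := ⟨by simp [unif]⟩

lemma unif_Iio {p : ℝ} (hp : p ∈ Set.Icc (0 : ℝ) 1) : unif (Set.Iio p) = ENNReal.ofReal p := by
  have : Set.Iio p ∩ Set.Icc 0 1 = Set.Ico 0 p := by
    ext t; simp only [Set.mem_inter_iff, Set.mem_Iio, Set.mem_Icc, Set.mem_Ico]
    constructor
    · rintro ⟨h1, h2, -⟩; exact ⟨h2, h1⟩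
    · rintro ⟨h1, h2⟩; exact ⟨h2, h1, h2.le.trans hp.2⟩
  rw [unif, Measure.restrict_apply measurableSet_Iio, this]
  simp

lemma unif_Ici {p : ℝ} (hp : p ∈ Set.Icc (0 : ℝ) 1) :
    unif (Set.Ici p) = ENNReal.ofReal (1 - p) := by
  have : Set.Ici p ∩ Set.Icc 0 1 = Set.Icc p 1 := by
    ext t; simp only [Set.mem_inter_iff, Set.mem_Ici, Set.mem_Icc]
    constructor
    · rintro ⟨h1, -, h2⟩; exact ⟨h1, h2⟩
    · rintro ⟨h1, h2⟩; exact ⟨h1, hp.1.trans h1, h2⟩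
  rw [unif, Measure.restrict_apply measurableSet_Ici, this]
  simp

/-- Independent uniform variables attached to all cookies. -/
def cookieMeasure : Measure (ℤ × ℕ → ℝ) := Measure.infinitePi fun _ => unif

instance : IsProbabilityMeasure cookieMeasure := by unfold cookieMeasure; infer_instance

/-- The arrows obtained from the environment `ω` and the uniform variables `u`. -/
def arrows (ω : CEnv) (u : ℤ × ℕ → ℝ) (z : ℤ) (i : ℕ) : Prop := u (z, i) < ω z i

/-- The values of the uniform variable of the cookie met by `x` at time `n` for which the arrow
agrees with the step of `x`. -/
def stepSet (ω : CEnv) (x : ℕ → ℤ) (n : ℕ) : Set ℝ :=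
  if x (n + 1) = x n + 1 then Set.Iio (ω (x n) (prevVisits x n))
  else if x (n + 1) = x n - 1 then Set.Ici (ω (x n) (prevVisits x n))
  else ∅

lemma measurableSet_stepSet (ω : CEnv) (x : ℕ → ℤ) (n : ℕ) : MeasurableSet (stepSet ω x n) := by
  unfold stepSet
  split_ifs
  exacts [measurableSet_Iio, measurableSet_Ici, MeasurableSet.empty]

lemma unif_stepSet {ω : CEnv} (hω : ∀ z i, ω z i ∈ Set.Icc (0 : ℝ) 1) (x : ℕ → ℤ) (n : ℕ) :
    unif (stepSet ω x n) = ENNReal.ofReal (stepProb ω x n) := by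
  unfold stepSet stepProb
  split_ifs
  · exact unif_Iio (hω _ _)
  · exact unif_Ici (hω _ _)
  · simp

lemma stepProb_nonneg {ω : CEnv} (hω : ∀ z i, ω z i ∈ Set.Icc (0 : ℝ) 1) (x : ℕ → ℤ) (n : ℕ) :
    0 ≤ stepProb ω x n := by
  unfold stepProb
  split_ifs
  · exact (hω _ _).1
  · exact sub_nonneg.2 (hω _ _).2
  · exact le_rfl

lemma setOf_walk_eq (ω : CEnv) {x : ℕ → ℤ} (hx : x 0 = 0) (n : ℕ) :
    {u | ∀ m ≤ n, walk (arrows ω u) m = x m} =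
      ⋂ m ∈ Finset.range n, (fun u => u (x m, prevVisits x m)) ⁻¹' stepSet ω x m := by
  ext u
  simp only [Set.mem_ofPred_eq, walk_eq_iff _ hx, Set.mem_iInter, Finset.mem_range]
  refine forall₂_congr fun m _ => ?_
  rw [Set.mem_preimage, stepSet]
  split_ifs with h1 h2
  · simp [h1, arrows]; omega
  · simp [h2, arrows]; omega
  · simp [h1, h2]

lemma setOf_walk_eq_empty (ω : CEnv) {x : ℕ → ℤ} (hx : x 0 ≠ 0) (n : ℕ) :
    {u | ∀ m ≤ n, walk (arrows ω u) m = x m} = ∅ :=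
  Set.eq_empty_of_forall_notMem fun _ hu => hx (hu 0 (Nat.zero_le _)).symm

lemma measurableSet_walk_eq (ω : CEnv) (x : ℕ → ℤ) (n : ℕ) :
    MeasurableSet {u | ∀ m ≤ n, walk (arrows ω u) m = x m} := by
  by_cases hx : x 0 = 0
  · rw [setOf_walk_eq ω hx]
    exact Finset.measurableSet_biInter _ fun m _ =>
      measurable_pi_apply _ (measurableSet_stepSet ω x m)
  · rw [setOf_walk_eq_empty ω hx]
    exact MeasurableSet.empty

lemma cookieMeasure_walk_eq {ω : CEnv} (hω : ∀ z i, ω z i ∈ Set.Icc (0 : ℝ) 1) (x : ℕ → ℤ)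
    (n : ℕ) : cookieMeasure {u | ∀ m ≤ n, walk (arrows ω u) m = x m} =
      ENNReal.ofReal (cylProb ω 0 x n) := by
  by_cases hx : x 0 = 0
  · have hind : iIndepFun (fun (c : ℤ × ℕ) (u : ℤ × ℕ → ℝ) => u c) cookieMeasure :=
      iIndepFun_infinitePi (P := fun _ : ℤ × ℕ => unif) (X := fun _ t => t)
        fun _ => measurable_id
    rw [setOf_walk_eq ω hx, cylProb, if_pos hx, one_mul,
      (hind.precomp (injective_site_prevVisits x)).measure_inter_preimage_eq_mul
        (Finset.range n) fun m _ => measurableSet_stepSet ω x m,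
      ENNReal.ofReal_prod_of_nonneg fun m _ => stepProb_nonneg hω x m]
    refine Finset.prod_congr rfl fun m _ => ?_
    rw [← unif_stepSet hω]
    exact (measurePreserving_eval_infinitePi (fun _ : ℤ × ℕ => unif) _).measure_preimage
      (measurableSet_stepSet ω x m).nullMeasurableSet
  · rw [setOf_walk_eq_empty ω hx, cylProb, if_neg hx]
    simp

lemma preimage_frestrictLe_singleton {α : Type*} (W : α → ℕ → ℤ) (n : ℕ)
    (s : Finset.Iic n → ℤ) :
    (fun u => Preorder.frestrictLe (π := fun _ : ℕ => ℤ) n (W u)) ⁻¹' {s} =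
      {u | ∀ m ≤ n, W u m = if h : m ∈ Finset.Iic n then s ⟨m, h⟩ else 0} := by
  ext u
  simp only [Set.mem_preimage, Set.mem_singleton_iff, funext_iff, Set.mem_ofPred_eq]
  constructor
  · intro h m hm
    rw [dif_pos (Finset.mem_Iic.2 hm)]
    exact h ⟨m, Finset.mem_Iic.2 hm⟩
  · rintro h ⟨m, hm⟩
    have := h m (Finset.mem_Iic.1 hm)
    rwa [dif_pos hm] at this

lemma measurable_walk (ω : CEnv) : Measurable fun u => walk (arrows ω u) := by
  refine measurable_pi_iff.2 fun n => ?_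
  have : Measurable fun u => Preorder.frestrictLe (π := fun _ : ℕ => ℤ) n (walk (arrows ω u)) :=
    measurable_to_countable' fun s => by
      rw [preimage_frestrictLe_singleton]
      exact measurableSet_walk_eq ω _ n
  exact (measurable_pi_apply (⟨n, Finset.mem_Iic.2 le_rfl⟩ : Finset.Iic n)).comp this

/-- Finite measures on integer paths are determined by the probabilities of initial segments. -/
lemma measure_ext_of_cylinders {P Q : Measure (ℕ → ℤ)} [IsFiniteMeasure P] [IsFiniteMeasure Q]
    (h : ∀ (x : ℕ → ℤ) (n : ℕ), P {Y | ∀ m ≤ n, Y m = x m} = Q {Y | ∀ m ≤ n, Y m = x m}) :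
    P = Q := by
  have hproj : IsProjectiveMeasureFamily (α := fun _ : ℕ => ℤ) fun I => Q.map I.restrict := by
    intro I J hJI
    dsimp only
    rw [Measure.map_map (Finset.measurable_restrict₂ _) (Finset.measurable_restrict _)]
    rfl
  refine IsProjectiveLimit.unique (P := fun I : Finset ℕ => Q.map I.restrict) ?_ fun _ => rfl
  rw [isProjectiveLimit_nat_iff hproj]
  intro n
  refine Measure.ext_of_singleton fun s => ?_
  change P.map (Preorder.frestrictLe (π := fun _ : ℕ => ℤ) n) {s} =
    Q.map (Preorder.frestrictLe (π := fun _ : ℕ => ℤ) n) {s}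
  rw [Measure.map_apply (Preorder.measurable_frestrictLe n) (MeasurableSet.singleton s),
    Measure.map_apply (Preorder.measurable_frestrictLe n) (MeasurableSet.singleton s)]
  have := preimage_frestrictLe_singleton (fun Y : ℕ → ℤ => Y) n s
  change Preorder.frestrictLe (π := fun _ : ℕ => ℤ) n ⁻¹' {s} = _ at this
  rw [this]
  exact h _ n

lemma map_walk_eq {ω : CEnv} (hω : ∀ z i, ω z i ∈ Set.Icc (0 : ℝ) 1) {P : Measure (ℕ → ℤ)}
    (hP : IsERWLaw ω 0 P) : cookieMeasure.map (fun u => walk (arrows ω u)) = P := by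
  have := hP.1
  refine measure_ext_of_cylinders fun x n => ?_
  have hm : MeasurableSet {Y : ℕ → ℤ | ∀ m ≤ n, Y m = x m} := by measurability
  rw [hP.2, Measure.map_apply (measurable_walk ω) hm, ← cookieMeasure_walk_eq hω]
  rfl

lemma measurableSet_forall_pos : MeasurableSet {Y : ℕ → ℤ | ∀ n > 0, 0 < Y n} := by
  measurability

end ArrowWalk

/-- Theorem 21. The probability never to return to the initial
point, `P_{0,ω}[∀ n > 0 : X_n > 0]`, is monotone increasing in `ω`. -/
theorem erw_return_probability_monotone (ω₁ ω₂ : CEnv)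
    (hω₁ : IsCookieEnv ω₁) (hω₂ : IsCookieEnv ω₂)
    (hle : ∀ z i, ω₁ z i ≤ ω₂ z i)
    (P₁ P₂ : Measure (ℕ → ℤ)) (hP₁ : IsERWLaw ω₁ 0 P₁) (hP₂ : IsERWLaw ω₂ 0 P₂) :
    P₁ {Y | ∀ n > 0, 0 < Y n} ≤ P₂ {Y | ∀ n > 0, 0 < Y n} := by
  have hmem : ∀ {ω : CEnv}, IsCookieEnv ω → ∀ z i, ω z i ∈ Set.Icc (0 : ℝ) 1 :=
    fun h z i => ⟨by linarith [(h z i).1], (h z i).2⟩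
  rw [← ArrowWalk.map_walk_eq (hmem hω₁) hP₁, ← ArrowWalk.map_walk_eq (hmem hω₂) hP₂,
    Measure.map_apply (ArrowWalk.measurable_walk ω₁) ArrowWalk.measurableSet_forall_pos,
    Measure.map_apply (ArrowWalk.measurable_walk ω₂) ArrowWalk.measurableSet_forall_pos]
  exact measure_mono fun u hu => (ArrowWalk.follows_walk _).forall_pos_mono
    (ArrowWalk.follows_walk _) (fun z i h => lt_of_lt_of_le h (hle z i)) hu

end
end

section
/- Let ℙ̄ be a probability measure on Ω₊ × Ω₊ such that ℙ̄[{(ω₁, ω₂) : ω₁(x,i) ≤ ω₂(x,i) for all x ∈ ℤ, i ≥ 1}] = 1 and such that, for i = 1, 2, the marginal sequence (ω_i(x))_{x≥0} is stationary and ergodic. Let v_i denote the ℙ̄ × P_{0,ω_i}-almost surely constant limit of X_n/n as n → ∞ (which exists by the strong law of large numbers for multi-excited random walks in stationary ergodic environments). Then v₁ ≤ v₂. -/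
open MeasureTheory Filter Set Topology ProbabilityTheory
open scoped ENNReal ENat

noncomputable section

/-- The path `x` starts at `0` and is driven by the stacks of arrows `a`: on its `(i+1)`-st
visit to `z` it steps to the right if `a z i` holds, and to the left otherwise. -/
def FollowsArrows (a : ℤ → ℕ → Prop) (x : ℕ → ℤ) : Prop :=
  x 0 = 0 ∧ ∀ n, (a (x n) (prevVisits x n) → x (n + 1) = x n + 1) ∧
    (¬ a (x n) (prevVisits x n) → x (n + 1) = x n - 1)

/-- The number of visits of `x` to `j` before time `n`. -/
def visitCount (x : ℕ → ℤ) (n : ℕ) (j : ℤ) : ℕ :=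
  ((Finset.range n).filter fun m => x m = j).card

lemma visitCount_succ (x : ℕ → ℤ) (n : ℕ) (j : ℤ) :
    visitCount x (n + 1) j = visitCount x n j + if x n = j then 1 else 0 := by
  unfold visitCount
  rw [Finset.range_add_one, Finset.filter_insert]
  split_ifs <;> simp

lemma prevVisits_eq_visitCount (x : ℕ → ℤ) (n : ℕ) : prevVisits x n = visitCount x n (x n) := rfl

open Classical in
/-- The number of right arrows among the lowest `n` arrows of a stack. -/
def rightCount (s : ℕ → Prop) (n : ℕ) : ℕ := ((Finset.range n).filter s).card

lemma rightCount_zero (s : ℕ → Prop) : rightCount s 0 = 0 := by simp [rightCount]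

lemma rightCount_succ_of_pos {s : ℕ → Prop} {n : ℕ} (h : s n) :
    rightCount s (n + 1) = rightCount s n + 1 := by
  unfold rightCount
  rw [Finset.range_add_one, Finset.filter_insert, if_pos h]
  simp

lemma rightCount_succ_of_neg {s : ℕ → Prop} {n : ℕ} (h : ¬ s n) :
    rightCount s (n + 1) = rightCount s n := by
  unfold rightCount
  rw [Finset.range_add_one, Finset.filter_insert, if_neg h]

lemma rightCount_mono (s : ℕ → Prop) : Monotone (rightCount s) := by
  refine monotone_nat_of_le_succ fun n => ?_
  by_cases h : s n
  · rw [rightCount_succ_of_pos h]; omega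
  · rw [rightCount_succ_of_neg h]

lemma rightCount_le_rightCount {s t : ℕ → Prop} (h : ∀ i, s i → t i) (n : ℕ) :
    rightCount s n ≤ rightCount t n := by
  unfold rightCount
  gcongr with i
  exact h i

lemma sub_rightCount_mono (s : ℕ → Prop) :
    Monotone fun n : ℕ => (n : ℤ) - rightCount s n := by
  refine monotone_nat_of_le_succ fun n => ?_
  by_cases h : s n
  · simp only [rightCount_succ_of_pos h]; push_cast; omega
  · simp only [rightCount_succ_of_neg h]; push_cast; omega

namespace FollowsArrows

variable {a b : ℤ → ℕ → Prop} {x y : ℕ → ℤ}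

/-- Conservation of crossings of the edge `{j, j+1}`: right steps from `j` minus left steps
from `j + 1`. -/
lemma crossings (h : FollowsArrows a x) (n : ℕ) (j : ℤ) :
    (rightCount (a j) (visitCount x n j) : ℤ) -
        (visitCount x n (j + 1) - rightCount (a (j + 1)) (visitCount x n (j + 1))) =
      (if j < x n then 1 else 0) - if j < 0 then 1 else 0 := by
  induction n with
  | zero => simp [visitCount, rightCount, h.1]
  | succ n ih =>
    have hstep := h.2 n
    rw [prevVisits_eq_visitCount] at hstep
    rw [visitCount_succ, visitCount_succ]
    by_cases h1 : x n = j
    · subst h1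
      have h2 : ¬ x n = x n + 1 := by omega
      simp only [if_true, if_neg h2, add_zero]
      by_cases ha : a (x n) (visitCount x n (x n))
      · rw [rightCount_succ_of_pos ha, hstep.1 ha]
        simp at ih ⊢; omega
      · rw [rightCount_succ_of_neg ha, hstep.2 ha]
        simp at ih ⊢; omega
    · by_cases h2 : x n = j + 1
      · rw [if_neg h1, if_pos h2, add_zero]
        rw [← h2] at ih ⊢
        by_cases ha : a (x n) (visitCount x n (x n))
        · rw [rightCount_succ_of_pos ha, hstep.1 ha]
          rw [if_pos (by omega)] at ih ⊢
          push_cast; omega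
        · rw [rightCount_succ_of_neg ha, hstep.2 ha]
          rw [if_pos (by omega)] at ih
          rw [if_neg (by omega)]
          push_cast; omega
      · simp only [if_neg h1, if_neg h2, add_zero]
        rw [ih]
        congr 1
        by_cases ha : a (x n) (visitCount x n (x n))
        · rw [hstep.1 ha]; split_ifs <;> omega
        · rw [hstep.2 ha]; split_ifs <;> omega

/-- If the path is to the right of `j`, then it left `j` to the right after its last visit. -/
lemma last_arrow (h : FollowsArrows a x) {n : ℕ} {j : ℤ} (hj : j < x n) {v : ℕ}
    (hv : visitCount x n j = v + 1) : a j v := by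
  induction n with
  | zero => simp [visitCount] at hv
  | succ n ih =>
    have hstep := h.2 n
    rw [prevVisits_eq_visitCount] at hstep
    rw [visitCount_succ] at hv
    by_cases h1 : x n = j
    · subst h1
      rw [if_pos rfl] at hv
      obtain rfl : visitCount x n (x n) = v := by omega
      by_contra ha
      have := hstep.2 ha
      omega
    · rw [if_neg h1] at hv
      refine ih ?_ hv
      by_cases ha : a (x n) (visitCount x n (x n))
      · have := hstep.1 ha; omega
      · have := hstep.2 ha; omega

lemma le_time (h : FollowsArrows a x) (n : ℕ) : x n ≤ n := by
  induction n with
  | zero => simp [h.1]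
  | succ n ih =>
    by_cases ha : a (x n) (prevVisits x n)
    · have := (h.2 n).1 ha; push_cast; omega
    · have := (h.2 n).2 ha; push_cast; omega

lemma lt_of_forall_ne (h : FollowsArrows a x) {k : ℤ} (hk : 0 < k) {N : ℕ}
    (hne : ∀ m ≤ N, x m ≠ k) : ∀ m ≤ N, x m < k := by
  intro m
  induction m with
  | zero => intro _; rw [h.1]; exact hk
  | succ m ih =>
    intro hm
    have h1 := ih (by omega)
    have h2 := hne (m + 1) hm
    by_cases ha : a (x m) (prevVisits x m)
    · have := (h.2 m).1 ha; omega
    · have := (h.2 m).2 ha; omega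

/-- To the left of the position of `x`, a comparison of the numbers of left steps from `j + 1`
yields a comparison of the numbers of visits to `j`. -/
lemma visitCount_le_of_leftCount_le (hab : ∀ z i, a z i → b z i) (hx : FollowsArrows a x)
    (hy : FollowsArrows b y) {N : ℕ} {j : ℤ} (hj : j < x N)
    (hle : (visitCount y N (j + 1) : ℤ) - rightCount (b (j + 1)) (visitCount y N (j + 1)) ≤
      visitCount x N (j + 1) - rightCount (a (j + 1)) (visitCount x N (j + 1))) :
    visitCount y N j ≤ visitCount x N j := by
  by_contra! hlt
  have h1 := hx.crossings N j
  have h2 := hy.crossings N j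
  rw [if_pos hj] at h1
  obtain ⟨v, hv⟩ : ∃ v, visitCount y N j = v + 1 := ⟨visitCount y N j - 1, by omega⟩
  have h3 := rightCount_le_rightCount (hab j) (visitCount x N j)
  have h4 := rightCount_mono (b j) (show visitCount x N j ≤ v by omega)
  have h5 := rightCount_mono (b j) (show v ≤ v + 1 by omega)
  rw [← hv] at h5
  by_cases hyj : j < y N
  · rw [if_pos hyj] at h2
    have h6 := rightCount_succ_of_pos (hy.last_arrow hyj hv)
    rw [← hv] at h6
    omega
  · rw [if_neg hyj] at h2
    omega

lemma leftCount_le_of_visitCount_le (hab : ∀ z i, a z i → b z i) {m n : ℕ} (j : ℤ)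
    (h : m ≤ n) : (m : ℤ) - rightCount (b j) m ≤ n - rightCount (a j) n := by
  have h1 := sub_rightCount_mono (b j) h
  have h2 := rightCount_le_rightCount (hab j) n
  simp only at h1
  omega

/-- More right arrows make the first passage to the right faster. -/
theorem exists_hit (hab : ∀ z i, a z i → b z i) (hx : FollowsArrows a x)
    (hy : FollowsArrows b y) {N : ℕ} {k : ℤ} (hk : 0 < k) (hN : x N = k) :
    ∃ m ≤ N, y m = k := by
  by_contra! hne
  have hlt := hy.lt_of_forall_ne hk hne
  have hvk : visitCount y N k = 0 := by
    unfold visitCount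
    rw [Finset.card_eq_zero, Finset.filter_eq_empty_iff]
    intro m hm
    exact hne m (Finset.mem_range.1 hm).le
  have hleft : ∀ d : ℕ, visitCount y N (k - d - 1) ≤ visitCount x N (k - d - 1) := by
    intro d
    induction d with
    | zero =>
      refine hx.visitCount_le_of_leftCount_le hab hy (by omega) ?_
      simp only [Nat.cast_zero, sub_zero, sub_add_cancel]
      exact leftCount_le_of_visitCount_le hab k (by omega)
    | succ d ih =>
      refine hx.visitCount_le_of_leftCount_le hab hy (by omega) ?_
      have : k - ((d + 1 : ℕ) : ℤ) - 1 + 1 = k - d - 1 := by push_cast; ring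
      rw [this]
      exact leftCount_le_of_visitCount_le hab _ ih
  have hle : ∀ j < k, visitCount y N j ≤ visitCount x N j := by
    intro j hj
    have := hleft (k - 1 - j).toNat
    have h2 : k - ((k - 1 - j).toNat : ℤ) - 1 = j := by omega
    rwa [h2] at this
  have hstrict : visitCount y N (k - 1) < visitCount x N (k - 1) := by
    refine lt_of_le_of_ne (hle _ (by omega)) fun heq => ?_
    have h1 := hx.crossings N (k - 1)
    have h2 := hy.crossings N (k - 1)
    have h3 := rightCount_le_rightCount (hab (k - 1)) (visitCount x N (k - 1))
    have h4 := sub_rightCount_mono (a k) (Nat.zero_le (visitCount x N k))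
    have h5 := hlt N le_rfl
    simp only [sub_add_cancel, hvk, heq, rightCount_zero] at h1 h2 h4
    rw [if_pos (by omega), if_neg (by omega)] at h1
    rw [if_neg (by omega), if_neg (by omega)] at h2
    omega
  set S : Finset ℤ := insert (k - 1) ((Finset.range N).image y) with hS
  have hyS : ∑ j ∈ S, visitCount y N j = N := by
    have := Finset.card_eq_sum_card_fiberwise (s := Finset.range N) (f := y) (t := S)
      (fun m hm => Finset.mem_insert_of_mem (Finset.mem_image_of_mem y hm))
    rw [Finset.card_range] at this
    exact this.symm
  have hxS : ∑ j ∈ S, visitCount x N j ≤ N := by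
    have := Finset.sum_card_fiberwise_eq_card_filter (Finset.range N) S x
    refine this.le.trans ((Finset.card_filter_le _ _).trans (Finset.card_range N).le)
  have : ∑ j ∈ S, visitCount y N j < ∑ j ∈ S, visitCount x N j := by
    refine Finset.sum_lt_sum (fun j hj => hle j ?_) ⟨k - 1, Finset.mem_insert_self _ _, hstrict⟩
    rcases Finset.mem_insert.1 hj with rfl | hj
    · omega
    · obtain ⟨m, hm, rfl⟩ := Finset.mem_image.1 hj
      exact hlt m (Finset.mem_range.1 hm).le
  omega

/-- Reflecting a path at the origin reflects and reverses its arrows. -/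
lemma neg (h : FollowsArrows a x) :
    FollowsArrows (fun z i => ¬ a (-z) i) (fun n => -x n) := by
  have hp : ∀ n, prevVisits (fun n => -x n) n = prevVisits x n := fun n => by
    simp [prevVisits]
  refine ⟨by simp [h.1], fun n => ?_⟩
  simp only [hp, neg_neg, not_not]
  exact ⟨fun ha => by rw [(h.2 n).2 ha]; ring, fun ha => by rw [(h.2 n).1 ha]; ring⟩

/-- More right arrows make the first passage to the left slower. -/
theorem exists_hit_neg (hab : ∀ z i, a z i → b z i) (hx : FollowsArrows a x)
    (hy : FollowsArrows b y) {N : ℕ} {k : ℤ} (hk : k < 0) (hN : y N = k) :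
    ∃ m ≤ N, x m = k := by
  obtain ⟨m, hm, h⟩ := exists_hit (fun z i h h' => h (hab _ _ h')) hy.neg hx.neg
    (N := N) (k := -k) (by omega) (by rw [hN])
  exact ⟨m, hm, neg_injective h⟩

end FollowsArrows

open Classical in
/-- The path driven by the stacks of arrows `a`. -/
def arrowWalk (a : ℤ → ℕ → Prop) : ℕ → ℤ
  | 0 => 0
  | n + 1 =>
    if a (arrowWalk a n) (∑ m : Fin n, if arrowWalk a m = arrowWalk a n then 1 else 0)
    then arrowWalk a n + 1 else arrowWalk a n - 1
termination_by n => n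
decreasing_by all_goals omega

open Classical in
lemma arrowWalk_succ (a : ℤ → ℕ → Prop) (n : ℕ) :
    arrowWalk a (n + 1) = if a (arrowWalk a n) (prevVisits (arrowWalk a) n)
      then arrowWalk a n + 1 else arrowWalk a n - 1 := by
  rw [arrowWalk, prevVisits, Finset.card_filter,
    Fin.sum_univ_eq_sum_range (fun m => if arrowWalk a m = arrowWalk a n then 1 else 0)]

lemma arrowWalk_zero (a : ℤ → ℕ → Prop) : arrowWalk a 0 = 0 := by rw [arrowWalk]

lemma followsArrows_arrowWalk (a : ℤ → ℕ → Prop) : FollowsArrows a (arrowWalk a) :=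
  ⟨arrowWalk_zero a, fun n =>
    ⟨fun h => by rw [arrowWalk_succ, if_pos h], fun h => by rw [arrowWalk_succ, if_neg h]⟩⟩

lemma prevVisits_congr {x y : ℕ → ℤ} {n : ℕ} (h : ∀ m ≤ n, x m = y m) :
    prevVisits x n = prevVisits y n := by
  unfold prevVisits
  congr 1
  refine Finset.filter_congr fun m hm => ?_
  rw [h m (Finset.mem_range.1 hm).le, h n le_rfl]

open Classical in
lemma arrowWalk_eq_upto_iff (a : ℤ → ℕ → Prop) (x : ℕ → ℤ) (n : ℕ) :
    (∀ m ≤ n, arrowWalk a m = x m) ↔ x 0 = 0 ∧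
      ∀ m < n, x (m + 1) = if a (x m) (prevVisits x m) then x m + 1 else x m - 1 := by
  constructor
  · intro h
    refine ⟨by rw [← h 0 (Nat.zero_le n), arrowWalk_zero], fun m hm => ?_⟩
    rw [← h (m + 1) hm, ← h m hm.le, arrowWalk_succ,
      prevVisits_congr fun i hi => h i (hi.trans hm.le)]
  · rintro ⟨h0, h⟩ m
    induction m using Nat.strong_induction_on with
    | _ m ih =>
      intro hm
      cases m with
      | zero => rw [arrowWalk_zero, h0]
      | succ m =>
        have heq : ∀ i ≤ m, arrowWalk a i = x i := fun i hi => ih i (by omega) (by omega)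
        rw [arrowWalk_succ, prevVisits_congr heq, heq m le_rfl, h m (by omega)]

lemma prevVisits_lt {x : ℕ → ℤ} {m n : ℕ} (hmn : m < n) (h : x m = x n) :
    prevVisits x m < prevVisits x n := by
  refine Finset.card_lt_card ⟨fun i hi => ?_, fun hsub => ?_⟩
  · simp only [Finset.mem_filter, Finset.mem_range] at hi ⊢
    exact ⟨hi.1.trans hmn, hi.2.trans h⟩
  · have := hsub (Finset.mem_filter.2 ⟨Finset.mem_range.2 hmn, h⟩)
    simp at this

/-- Distinct times consume distinct cookies. -/
lemma cookie_injective (x : ℕ → ℤ) : Function.Injective fun m => (x m, prevVisits x m) := by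
  intro m n h
  simp only [Prod.mk.injEq] at h
  rcases lt_trichotomy m n with hlt | heq | hgt
  · exact absurd h.2 (prevVisits_lt hlt h.1).ne
  · exact heq
  · exact absurd h.2 (prevVisits_lt hgt h.1.symm).ne'

/-- Independent uniform variables attached to all cookies. -/
abbrev cookieMeasure : Measure (ℤ × ℕ → unitInterval) :=
  Measure.infinitePi fun _ => (volume : Measure unitInterval)

/-- The arrows generated from the uniform variables `U` in the cookie environment `ω`. -/
def arrows (ω : CEnv) (U : ℤ × ℕ → unitInterval) (z : ℤ) (i : ℕ) : Prop := (U (z, i) : ℝ) < ω z i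

lemma measurableSet_arrows (ω : CEnv) (z : ℤ) (i : ℕ) : MeasurableSet {U | arrows ω U z i} := by
  unfold arrows
  exact measurableSet_lt (by fun_prop) measurable_const

lemma measurable_arrowWalk_apply (ω : CEnv) (n : ℕ) :
    Measurable fun U => arrowWalk (arrows ω U) n := by
  induction n using Nat.strong_induction_on with
  | _ n ih =>
    cases n with
    | zero => simp only [arrowWalk_zero]; exact measurable_const
    | succ n =>
      simp only [arrowWalk_succ]
      have hn := ih n (by omega)
      have hv : Measurable fun U => prevVisits (arrowWalk (arrows ω U)) n := by
        simp only [prevVisits, Finset.card_filter]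
        refine Finset.measurable_sum _ fun m hm => Measurable.ite ?_ measurable_const
          measurable_const
        exact measurableSet_eq_fun (ih m (by have := Finset.mem_range.1 hm; omega)) hn
      refine Measurable.ite ?_ (hn.add_const 1) (hn.sub_const 1)
      have : {U | arrows ω U (arrowWalk (arrows ω U) n) (prevVisits (arrowWalk (arrows ω U)) n)} =
          ⋃ p : ℤ × ℕ, {U | arrowWalk (arrows ω U) n = p.1} ∩
            {U | prevVisits (arrowWalk (arrows ω U)) n = p.2} ∩ {U | arrows ω U p.1 p.2} := by
        ext U
        simp
      rw [this]
      exact MeasurableSet.iUnion fun p =>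
        ((hn (measurableSet_singleton p.1)).inter (hv (measurableSet_singleton p.2))).inter
          (measurableSet_arrows ω p.1 p.2)

lemma measurable_arrowWalk (ω : CEnv) : Measurable fun U => arrowWalk (arrows ω U) :=
  measurable_pi_lambda _ fun n => measurable_arrowWalk_apply ω n

lemma volume_coe_lt {p : ℝ} (hp : p ∈ Set.Icc (0 : ℝ) 1) :
    volume {u : unitInterval | (u : ℝ) < p} = ENNReal.ofReal p :=
  unitInterval.volume_Iio ⟨p, hp⟩

lemma volume_not_coe_lt {p : ℝ} (hp : p ∈ Set.Icc (0 : ℝ) 1) :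
    volume {u : unitInterval | ¬ (u : ℝ) < p} = ENNReal.ofReal (1 - p) := by
  simp only [not_lt]
  exact unitInterval.volume_Ici ⟨p, hp⟩

lemma IsCookieEnv.mem_unit {ω : CEnv} (h : IsCookieEnv ω) (z : ℤ) (i : ℕ) :
    ω z i ∈ Set.Icc (0 : ℝ) 1 := ⟨by linarith [(h z i).1], (h z i).2⟩

lemma stepProb_nonneg {ω : CEnv} (h : IsCookieEnv ω) (x : ℕ → ℤ) (n : ℕ) :
    0 ≤ stepProb ω x n := by
  have := h.mem_unit (x n) (prevVisits x n)
  unfold stepProb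
  split_ifs
  · exact this.1
  · linarith [this.2]
  · exact le_rfl

lemma volume_step {ω : CEnv} (h : IsCookieEnv ω) (x : ℕ → ℤ) (n : ℕ) :
    volume {u : unitInterval | x (n + 1) =
      if (u : ℝ) < ω (x n) (prevVisits x n) then x n + 1 else x n - 1} =
      ENNReal.ofReal (stepProb ω x n) := by
  have hp := h.mem_unit (x n) (prevVisits x n)
  unfold stepProb
  split_ifs with h1 h2
  · rw [← volume_coe_lt hp]
    congr 1
    ext u
    simp only [Set.mem_ofPred_eq]
    split_ifs with hu <;> simp only [hu, iff_true, iff_false] <;> omega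
  · rw [← volume_not_coe_lt hp]
    congr 1
    ext u
    simp only [Set.mem_ofPred_eq]
    split_ifs with hu <;> simp only [hu, not_true, not_false_iff, iff_true, iff_false] <;> omega
  · rw [ENNReal.ofReal_zero, ← measure_empty (μ := (volume : Measure unitInterval))]
    congr 1
    ext u
    simp only [Set.mem_ofPred_eq, Set.mem_empty_iff_false, iff_false]
    split_ifs <;> assumption

lemma measurableSet_upto (x : ℕ → ℤ) (n : ℕ) :
    MeasurableSet {Y : ℕ → ℤ | ∀ m ≤ n, Y m = x m} := by
  simp only [Set.ofPred_forall]
  exact MeasurableSet.iInter fun m => MeasurableSet.iInter fun _ =>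
    measurableSet_eq_fun (measurable_pi_apply m) measurable_const

open Classical in
/-- The walk driven by the arrows has the law of the excited random walk. -/
theorem isERWLaw_map_arrowWalk {ω : CEnv} (h : IsCookieEnv ω) :
    IsERWLaw ω 0 (cookieMeasure.map fun U => arrowWalk (arrows ω U)) := by
  refine ⟨Measure.isProbabilityMeasure_map (measurable_arrowWalk ω).aemeasurable, fun x n => ?_⟩
  rw [Measure.map_apply (measurable_arrowWalk ω) (measurableSet_upto x n)]
  simp only [Set.preimage_ofPred_eq, arrowWalk_eq_upto_iff]
  unfold cylProb
  by_cases h0 : x 0 = 0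
  swap
  · simp [h0]
  simp only [h0, true_and, if_true, one_mul]
  rw [ENNReal.ofReal_prod_of_nonneg fun m _ => stepProb_nonneg h x m]
  set idx : ℕ → ℤ × ℕ := fun m => (x m, prevVisits x m) with hidx
  have hinj : Function.Injective idx := cookie_injective x
  set B : ℕ → Set unitInterval := fun m => {u | x (m + 1) =
      if (u : ℝ) < ω (x m) (prevVisits x m) then x m + 1 else x m - 1} with hB
  have hBm : ∀ m, MeasurableSet (B m) := fun m => by
    have : MeasurableSet {u : unitInterval | (u : ℝ) < ω (x m) (prevVisits x m)} :=
      measurableSet_lt (by fun_prop) measurable_const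
    exact measurableSet_eq_fun measurable_const
      (Measurable.ite this measurable_const measurable_const)
  have hevent : {U : ℤ × ℕ → unitInterval | ∀ m < n, x (m + 1) =
      if arrows ω U (x m) (prevVisits x m) then x m + 1 else x m - 1} =
      Set.pi ((Finset.range n).image idx) fun i => B (Function.invFun idx i) := by
    ext U
    simp only [Set.mem_ofPred_eq, Set.mem_pi, Finset.mem_coe, Finset.mem_image, Finset.mem_range,
      forall_exists_index, and_imp, forall_apply_eq_imp_iff₂, Function.leftInverse_invFun hinj _]
    rfl
  rw [hevent, Measure.infinitePi_pi _ fun i _ => hBm _, Finset.prod_image hinj.injOn]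
  refine Finset.prod_congr rfl fun m _ => ?_
  rw [Function.leftInverse_invFun hinj m]
  exact volume_step h x m

/-- The law of the excited random walk is determined by its cylinder probabilities. -/
theorem IsERWLaw.unique {ω : CEnv} {x0 : ℤ} {P Q : Measure (ℕ → ℤ)} (hP : IsERWLaw ω x0 P)
    (hQ : IsERWLaw ω x0 Q) : P = Q := by
  have := hP.1
  have := hQ.1
  set C : Set (Set (ℕ → ℤ)) :=
    Set.range fun p : (ℕ → ℤ) × ℕ => {Y : ℕ → ℤ | ∀ m ≤ p.2, Y m = p.1 m} with hC
  refine ext_of_generate_finite C (le_antisymm ?_ ?_) ?_ ?_ (by simp)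
  · refine iSup_le fun n => ?_
    rw [← measurable_iff_comap_le]
    refine @measurable_to_countable' _ _ _ _ (MeasurableSpace.generateFrom C) _ fun z => ?_
    have : (fun Y : ℕ → ℤ => Y n) ⁻¹' {z} = ⋃ l : {l : Fin (n + 1) → ℤ // l (Fin.last n) = z},
        {Y : ℕ → ℤ | ∀ m ≤ n, Y m = l.1 (Fin.ofNat (n + 1) m)} := by
      ext Y
      simp only [Set.mem_preimage, Set.mem_singleton_iff, Set.mem_iUnion, Set.mem_ofPred_eq]
      constructor
      · intro hY
        refine ⟨⟨fun i => Y i, by simpa using hY⟩, fun m hm => ?_⟩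
        simp [Nat.mod_eq_of_lt (Nat.lt_succ_of_le hm)]
      · rintro ⟨⟨l, rfl⟩, hY⟩
        exact (hY n le_rfl).trans (congrArg l (Fin.ext (Nat.mod_eq_of_lt n.lt_succ_self)))
    rw [this]
    exact MeasurableSet.iUnion fun l => MeasurableSpace.measurableSet_generateFrom
      ⟨(fun m => l.1 (Fin.ofNat (n + 1) m), n), rfl⟩
  · refine MeasurableSpace.generateFrom_le ?_
    rintro _ ⟨p, rfl⟩
    exact measurableSet_upto p.1 p.2
  · rintro _ ⟨p, rfl⟩ _ ⟨q, rfl⟩ ⟨Z, hZp, hZq⟩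
    refine ⟨(Z, max p.2 q.2), ?_⟩
    ext Y
    simp only [Set.mem_ofPred_eq, Set.mem_inter_iff] at hZp hZq ⊢
    constructor
    · exact fun hY => ⟨fun m hm => (hY m (hm.trans (le_max_left _ _))).trans (hZp m hm),
        fun m hm => (hY m (hm.trans (le_max_right _ _))).trans (hZq m hm)⟩
    · rintro ⟨h1, h2⟩ m hm
      rcases le_max_iff.1 hm with hm | hm
      · rw [h1 m hm, hZp m hm]
      · rw [h2 m hm, hZq m hm]
  · rintro _ ⟨p, rfl⟩
    rw [hP.2, hQ.2]

/-- The cookie environment of the simple symmetric random walk. -/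
def fairEnv : CEnv := fun _ _ => 1 / 2

lemma isCookieEnv_fairEnv : IsCookieEnv fairEnv := fun _ _ => by
  norm_num [fairEnv]

lemma cylProb_fairEnv_neg (x : ℕ → ℤ) (n : ℕ) :
    cylProb fairEnv 0 (fun m => -x m) n = cylProb fairEnv 0 x n := by
  unfold cylProb
  congr 1
  · simp
  · refine Finset.prod_congr rfl fun m _ => ?_
    unfold stepProb fairEnv
    dsimp only
    split_ifs <;> first | omega | norm_num

lemma isERWLaw_fairEnv_neg {P : Measure (ℕ → ℤ)} (hP : IsERWLaw fairEnv 0 P) :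
    IsERWLaw fairEnv 0 (P.map fun Y n => -Y n) := by
  have := hP.1
  have hm : Measurable fun (Y : ℕ → ℤ) n => -Y n := by fun_prop
  refine ⟨Measure.isProbabilityMeasure_map hm.aemeasurable, fun x n => ?_⟩
  rw [Measure.map_apply hm (measurableSet_upto x n), ← cylProb_fairEnv_neg, ← hP.2]
  simp only [Set.preimage_ofPred_eq, neg_eq_iff_eq_neg]

/-- If the simple random walk is almost surely unbounded below, then it is almost surely
unbounded above. -/
lemma ae_fair_unbounded
    (h : ∀ᵐ U ∂cookieMeasure, ∀ K : ℤ, ∃ n, arrowWalk (arrows fairEnv U) n ≤ K) :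
    ∀ᵐ U ∂cookieMeasure, ∀ K : ℤ, ∃ n, K ≤ arrowWalk (arrows fairEnv U) n := by
  have hlaw := isERWLaw_map_arrowWalk isCookieEnv_fairEnv
  have hmeas : MeasurableSet {Y : ℕ → ℤ | ∀ K : ℤ, ∃ n, Y n ≤ K} := by
    simp only [Set.ofPred_forall, Set.ofPred_exists]
    exact MeasurableSet.iInter fun K => MeasurableSet.iUnion fun n =>
      measurable_pi_apply n measurableSet_Iic
  have h1 : ∀ᵐ Y ∂(cookieMeasure.map fun U => arrowWalk (arrows fairEnv U)),
      ∀ K : ℤ, ∃ n, Y n ≤ K :=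
    (ae_map_iff (measurable_arrowWalk _).aemeasurable hmeas).2 h
  rw [← (isERWLaw_fairEnv_neg hlaw).unique hlaw] at h1
  have h2 := ae_of_ae_map (measurable_arrowWalk _).aemeasurable
    (ae_of_ae_map (Measurable.aemeasurable (by fun_prop)) h1)
  filter_upwards [h2] with U hU K
  obtain ⟨n, hn⟩ := hU (-K)
  exact ⟨n, by omega⟩

lemma arrows_mono {ω₁ ω₂ : CEnv} (h : ∀ z i, ω₁ z i ≤ ω₂ z i) (U : ℤ × ℕ → unitInterval)
    (z : ℤ) (i : ℕ) (ha : arrows ω₁ U z i) : arrows ω₂ U z i := lt_of_lt_of_le ha (h z i)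

/-- A walk with cookies of strength at least `1/2` has nonnegative speed. -/
theorem speed_nonneg {ω : CEnv} (hω : IsCookieEnv ω) {v : ℝ}
    (hv : ∀ᵐ U ∂cookieMeasure,
      Tendsto (fun n : ℕ => (arrowWalk (arrows ω U) n : ℝ) / n) atTop (𝓝 v)) : 0 ≤ v := by
  by_contra! hneg
  have htend : ∀ᵐ U ∂cookieMeasure, Tendsto (arrowWalk (arrows ω U)) atTop atBot := by
    filter_upwards [hv] with U hU
    rw [← tendsto_intCast_atBot_iff (R := ℝ)]
    refine (hU.neg_mul_atTop hneg tendsto_natCast_atTop_atTop).congr' ?_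
    filter_upwards [eventually_gt_atTop 0] with n hn
    field_simp
  have hle : ∀ z i, fairEnv z i ≤ ω z i := fun z i => (hω z i).1
  have hbelow : ∀ᵐ U ∂cookieMeasure, ∀ K : ℤ, ∃ n, arrowWalk (arrows fairEnv U) n ≤ K := by
    filter_upwards [htend] with U hU K
    obtain ⟨n, hn⟩ := (hU.eventually_le_atBot (min K (-1))).exists
    obtain ⟨m, -, hm⟩ := FollowsArrows.exists_hit_neg (arrows_mono hle U)
      (followsArrows_arrowWalk _) (followsArrows_arrowWalk _) (N := n) (by omega) rfl
    exact ⟨m, by omega⟩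
  obtain ⟨U, hU, hU'⟩ := (htend.and (ae_fair_unbounded hbelow)).exists
  obtain ⟨K, hK⟩ : BddAbove (Set.range (arrowWalk (arrows ω U))) :=
    bddAbove_range_of_tendsto_atTop_atBot hU
  obtain ⟨n, hn⟩ := hU' (max K 0 + 1)
  obtain ⟨m, -, hm⟩ := FollowsArrows.exists_hit (arrows_mono hle U)
    (followsArrows_arrowWalk _) (followsArrows_arrowWalk _) (N := n) (by omega) rfl
  have := hK (Set.mem_range_self m)
  omega

/-- More right arrows make the speed larger, if the larger speed is nonnegative. -/
theorem FollowsArrows.speed_le {a b : ℤ → ℕ → Prop} {x y : ℕ → ℤ} (hab : ∀ z i, a z i → b z i)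
    (hx : FollowsArrows a x) (hy : FollowsArrows b y) {v₁ v₂ : ℝ} (h₂ : 0 ≤ v₂)
    (hv₁ : Tendsto (fun n : ℕ => (x n : ℝ) / n) atTop (𝓝 v₁))
    (hv₂ : Tendsto (fun n : ℕ => (y n : ℝ) / n) atTop (𝓝 v₂)) : v₁ ≤ v₂ := by
  by_contra! hlt
  obtain ⟨c, hc₂, hc₁⟩ := exists_between hlt
  have hc : 0 < c := h₂.trans_lt hc₂
  obtain ⟨N, hN⟩ := eventually_atTop.1
    ((hv₁.eventually (lt_mem_nhds hc₁)).and (hv₂.eventually (gt_mem_nhds hc₂)))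
  obtain ⟨M, hM⟩ := exists_nat_gt (N / c)
  set n := max (max N M) 1
  have hn : 0 < n := by omega
  have hn' : (0 : ℝ) < n := Nat.cast_pos.2 hn
  have hxn : c * n < x n := (lt_div_iff₀ hn').1 (hN n (by omega)).1
  have hNn : (N : ℝ) < c * n := by
    have h1 : (M : ℝ) ≤ n := Nat.cast_le.2 (by omega)
    rw [mul_comm]
    exact (div_lt_iff₀ hc).1 (hM.trans_le h1)
  have hpos : 0 < x n := by
    have : (0 : ℝ) < x n := (by positivity : 0 < c * n).trans hxn
    exact_mod_cast this
  obtain ⟨m, hmn, hm⟩ := hx.exists_hit hab hy hpos rfl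
  have hmn' : (m : ℝ) ≤ n := Nat.cast_le.2 hmn
  rw [← hm] at hxn hpos
  rcases le_or_gt N m with hNm | hNm
  · have hm0 : (0 : ℝ) < m := by
      have : 0 < m := by
        rcases Nat.eq_zero_or_pos m with rfl | h
        · rw [hy.1] at hpos; omega
        · exact h
      exact_mod_cast this
    have h1 := (div_lt_iff₀ hm0).1 (hN m hNm).2
    have h2 := mul_le_mul_of_nonneg_left hmn' hc.le
    linarith
  · have h1 : (y m : ℝ) ≤ m := by exact_mod_cast hy.le_time m
    have h2 : (m : ℝ) < N := Nat.cast_lt.2 hNm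
    linarith

/-- Theorem 22, monotonicity of the speed. Let `PrB` be a coupling
of two environments with `ω₁ ≤ ω₂` a.s., both marginals stationary and ergodic, and let
`v₁, v₂` be the a.s. constant limits of `X_n/n` for the corresponding walks. Then
`v₁ ≤ v₂`. -/
theorem erw_speed_monotone (PrB : Measure (CEnv × CEnv)) [IsProbabilityMeasure PrB]
    (hle : ∀ᵐ q ∂PrB, ∀ z i, q.1 z i ≤ q.2 z i)
    (hcookie : ∀ᵐ q ∂PrB, IsCookieEnv q.1 ∧ IsCookieEnv q.2)
    (hstat1 : IsStatErgEnv (PrB.map Prod.fst))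
    (hstat2 : IsStatErgEnv (PrB.map Prod.snd))
    (P : CEnv → Measure (ℕ → ℤ)) (hP : ∀ ω, IsCookieEnv ω → IsERWLaw ω 0 (P ω))
    (v₁ v₂ : ℝ)
    (hv₁ : ∀ᵐ q ∂PrB, ∀ᵐ Y ∂(P q.1),
      Tendsto (fun n : ℕ => (Y n : ℝ) / (n : ℝ)) atTop (𝓝 v₁))
    (hv₂ : ∀ᵐ q ∂PrB, ∀ᵐ Y ∂(P q.2),
      Tendsto (fun n : ℕ => (Y n : ℝ) / (n : ℝ)) atTop (𝓝 v₂)) :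
    v₁ ≤ v₂ := by
  obtain ⟨q, hq, ⟨hc₁, hc₂⟩, hq₁, hq₂⟩ := (hle.and (hcookie.and (hv₁.and hv₂))).exists
  rw [(hP _ hc₁).unique (isERWLaw_map_arrowWalk hc₁)] at hq₁
  rw [(hP _ hc₂).unique (isERWLaw_map_arrowWalk hc₂)] at hq₂
  have hU₁ := ae_of_ae_map (measurable_arrowWalk q.1).aemeasurable hq₁
  have hU₂ := ae_of_ae_map (measurable_arrowWalk q.2).aemeasurable hq₂
  obtain ⟨U, h₁, h₂⟩ := (hU₁.and hU₂).exists
  exact (followsArrows_arrowWalk _).speed_le (arrows_mono hq U) (followsArrows_arrowWalk _)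
    (speed_nonneg hc₂ hU₂) h₁ h₂

end
end
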